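/- arXiv:1412.2957 — 4 statements merged into one kernel-verified Lean document; each statement's English description precedes it below -/
import Mathlib

section
/- Fix a positive integer k and weights w : {1,…,k} → ℕ. Let α, β^(1), …, β^(N) be dimension vectors of weight type w with α = β^(1) + ⋯ + β^(N) componentwise, and suppose each β^(l) is monotone. Then Σ_{l=1}^N ( (β^(l)₀)² − q(β^(l)) ) ≤ α₀² − q(α); that is, for genus g = 1 and r = 1 the almost good inequality r − 1 + Σ_l (β^(l)₀)² − Σ_l q(β^(l)) ≤ α₀² − q(α) of Theorem 3.7 holds automatically. -/
open Finset

/-- The Euler form `⟨α, β⟩ = α₀·β₀ + Σᵢ Σⱼ (β_{i,j+1} − β_{i,j})·α_{i,j+1}` of two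
dimension vectors of weight type `w`, where a dimension vector is given by its
rank `a0` together with flag dimensions `a i j` (with the convention `a i 0 = a0`). -/
def eulerForm (k : ℕ) (w : Fin k → ℕ) (a0 : ℕ) (a : Fin k → ℕ → ℕ)
    (b0 : ℕ) (b : Fin k → ℕ → ℕ) : ℤ :=
  (a0 : ℤ) * (b0 : ℤ) + ∑ i : Fin k, ∑ j ∈ Finset.range (w i),
    ((b i (j + 1) : ℤ) - (b i j : ℤ)) * (a i (j + 1) : ℤ)

/-- `q(α) = ⟨α, α⟩`. -/
def qForm (k : ℕ) (w : Fin k → ℕ) (a0 : ℕ) (a : Fin k → ℕ → ℕ) : ℤ :=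
  eulerForm k w a0 a a0 a

/-- For nonnegative families, the sum of products is at most the product of the sums. -/
theorem sum_mul_le_sum_mul_sum_of_nonneg {ι R : Type*} [CommSemiring R] [PartialOrder R]
    [IsOrderedRing R] (s : Finset ι) {x y : ι → R} (hx : ∀ l ∈ s, 0 ≤ x l)
    (hy : ∀ l ∈ s, 0 ≤ y l) :
    ∑ l ∈ s, x l * y l ≤ (∑ l ∈ s, x l) * ∑ l ∈ s, y l := by
  rw [Finset.sum_mul]
  exact Finset.sum_le_sum fun l hl =>
    mul_le_mul_of_nonneg_left (Finset.single_le_sum hy hl) (hx l hl)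

theorem sq_sub_qForm (k : ℕ) (w : Fin k → ℕ) (a0 : ℕ) (a : Fin k → ℕ → ℕ) :
    (a0 : ℤ) ^ 2 - qForm k w a0 a = ∑ i : Fin k, ∑ j ∈ Finset.range (w i),
      ((a i j : ℤ) - (a i (j + 1) : ℤ)) * (a i (j + 1) : ℤ) := by
  rw [qForm, eulerForm, ← sq, sub_add_cancel_left]
  simp only [← Finset.sum_neg_distrib, ← neg_mul, neg_sub]

theorem genus_one_r_one_almost_good_automatic
    (k : ℕ) (hk : 0 < k) (w : Fin k → ℕ) (N : ℕ)
    (α0 : ℕ) (α : Fin k → ℕ → ℕ) (hα0 : ∀ i, α i 0 = α0)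
    (β0 : Fin N → ℕ) (β : Fin N → Fin k → ℕ → ℕ)
    (hβ0 : ∀ l i, β l i 0 = β0 l)
    (hsum0 : α0 = ∑ l, β0 l)
    (hsum : ∀ i j, α i j = ∑ l, β l i j)
    (hmono : ∀ l i j, j < w i → β l i (j + 1) ≤ β l i j) :
    (∑ l, ((β0 l : ℤ) ^ 2 - qForm k w (β0 l) (β l)))
      ≤ (α0 : ℤ) ^ 2 - qForm k w α0 α := by
  simp only [sq_sub_qForm]
  rw [Finset.sum_comm]
  refine Finset.sum_le_sum fun i _ => ?_
  rw [Finset.sum_comm]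
  refine Finset.sum_le_sum fun j hj => ?_
  simp only [hsum, Nat.cast_sum, ← Finset.sum_sub_distrib]
  refine sum_mul_le_sum_mul_sum_of_nonneg _ (fun l _ => ?_) fun l _ => Int.natCast_nonneg _
  exact sub_nonneg.2 (Int.ofNat_le.2 (hmono l i j (Finset.mem_range.1 hj)))
end

section
/- Fix a positive integer k and weights w : {1,…,k} → ℕ. Let g ≥ 2 be an integer, let α, β^(1), …, β^(N) be dimension vectors of weight type w with N ≥ 2 and α = β^(1) + ⋯ + β^(N) componentwise, suppose each β^(l) is monotone with β^(l)₀ ≥ 1, and let r be an integer with 1 ≤ r ≤ N. Then the strict inequality r − 1 + g·Σ_{l=1}^N (β^(l)₀)² − Σ_{l=1}^N q(β^(l)) < g·α₀² − q(α) holds. -/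
open Finset

lemma sum_mul_sum_le_sum_mul_of_nonpos_of_nonneg {ι : Type*} (s : Finset ι) (d e : ι → ℤ)
    (hd : ∀ l ∈ s, d l ≤ 0) (he : ∀ l ∈ s, 0 ≤ e l) :
    (∑ l ∈ s, d l) * ∑ l ∈ s, e l ≤ ∑ l ∈ s, d l * e l := by
  rw [Finset.sum_mul]
  exact Finset.sum_le_sum fun l hl =>
    mul_le_mul_of_nonpos_left (Finset.single_le_sum he hl) (hd l hl)

lemma card_mul_card_sub_one_le_sq_sum_sub_sum_sq {ι : Type*} (s : Finset ι) (b : ι → ℤ)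
    (hb : ∀ l ∈ s, 1 ≤ b l) :
    (#s : ℤ) * (#s - 1) ≤ (∑ l ∈ s, b l) ^ 2 - ∑ l ∈ s, b l ^ 2 := by
  have key : ∀ l ∈ s, (#s : ℤ) - 1 ≤ b l * ((∑ m ∈ s, b m) - b l) := by
    intro l hl
    have h₁ : b l - 1 ≤ ∑ m ∈ s, (b m - 1) :=
      Finset.single_le_sum (f := fun m => b m - 1) (fun m hm => sub_nonneg.2 (hb m hm)) hl
    rw [Finset.sum_sub_distrib, Finset.sum_const, nsmul_eq_mul, mul_one] at h₁
    have h₂ : (1 : ℤ) ≤ #s := by exact_mod_cast Finset.card_pos.2 ⟨l, hl⟩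
    nlinarith [hb l hl]
  calc (#s : ℤ) * (#s - 1) = ∑ _l ∈ s, ((#s : ℤ) - 1) := by
        rw [Finset.sum_const, nsmul_eq_mul]
    _ ≤ ∑ l ∈ s, b l * ((∑ m ∈ s, b m) - b l) := Finset.sum_le_sum key
    _ = (∑ l ∈ s, b l) ^ 2 - ∑ l ∈ s, b l ^ 2 := by
        simp only [mul_sub, Finset.sum_sub_distrib, ← Finset.sum_mul, sq]

lemma qForm_sub_sq_le_sum {ι : Type*} [Fintype ι] (k : ℕ) (w : Fin k → ℕ)
    (α0 : ℕ) (α : Fin k → ℕ → ℕ) (β0 : ι → ℕ) (β : ι → Fin k → ℕ → ℕ)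
    (hsum : ∀ i j, α i j = ∑ l, β l i j)
    (hmono : ∀ l i j, j < w i → β l i (j + 1) ≤ β l i j) :
    qForm k w α0 α - (α0 : ℤ) ^ 2 ≤ ∑ l, qForm k w (β0 l) (β l) - ∑ l, (β0 l : ℤ) ^ 2 := by
  simp only [qForm, eulerForm, ← sq, Finset.sum_add_distrib, add_sub_cancel_left]
  rw [Finset.sum_comm]
  refine Finset.sum_le_sum fun i _ => ?_
  rw [Finset.sum_comm]
  refine Finset.sum_le_sum fun j hj => ?_
  rw [hsum, hsum]
  push_cast
  rw [← Finset.sum_sub_distrib]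
  refine sum_mul_sum_le_sum_mul_of_nonpos_of_nonneg _ _ _ (fun l _ => ?_) fun l _ => by positivity
  exact sub_nonpos.2 (by exact_mod_cast hmono l i j (Finset.mem_range.1 hj))

theorem higher_genus_very_good_automatic
    (k : ℕ) (hk : 0 < k) (w : Fin k → ℕ) (g : ℤ) (hg : 2 ≤ g) (N : ℕ) (hN : 2 ≤ N)
    (α0 : ℕ) (α : Fin k → ℕ → ℕ) (hα0 : ∀ i, α i 0 = α0)
    (β0 : Fin N → ℕ) (β : Fin N → Fin k → ℕ → ℕ)
    (hβ0 : ∀ l i, β l i 0 = β0 l)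
    (hsum0 : α0 = ∑ l, β0 l)
    (hsum : ∀ i j, α i j = ∑ l, β l i j)
    (hmono : ∀ l i j, j < w i → β l i (j + 1) ≤ β l i j)
    (hpos : ∀ l, 1 ≤ β0 l)
    (r : ℤ) (hr1 : 1 ≤ r) (hrN : r ≤ (N : ℤ)) :
    r - 1 + g * ∑ l, (β0 l : ℤ) ^ 2 - ∑ l, qForm k w (β0 l) (β l)
      < g * (α0 : ℤ) ^ 2 - qForm k w α0 α := by
  have hq := qForm_sub_sq_le_sum k w α0 α β0 β hsum hmono
  have hN' : (2 : ℤ) ≤ N := by exact_mod_cast hN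
  have hsq := card_mul_card_sub_one_le_sq_sum_sub_sum_sq Finset.univ (fun l => (β0 l : ℤ))
    fun l _ => by exact_mod_cast hpos l
  have hcast : (α0 : ℤ) = ∑ l, (β0 l : ℤ) := by rw [hsum0]; push_cast; rfl
  rw [← hcast, Finset.card_univ, Fintype.card_fin] at hsq
  have hgap : (N : ℤ) - 1 < (α0 : ℤ) ^ 2 - ∑ l, (β0 l : ℤ) ^ 2 := by nlinarith
  have hg' : (α0 : ℤ) ^ 2 - ∑ l, (β0 l : ℤ) ^ 2 ≤
      (g - 1) * ((α0 : ℤ) ^ 2 - ∑ l, (β0 l : ℤ) ^ 2) :=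
    le_mul_of_one_le_left (by linarith) (by linarith)
  linarith
end

section
/- Fix a positive integer k and weights w : {1,…,k} → ℕ. Let β^(1), …, β^(N) be dimension vectors of weight type w with N ≥ 2, each monotone with β^(l)₀ ≥ 1, and let α = β^(1) + ⋯ + β^(N) componentwise. Suppose i is an index with w_i ≥ 1 such that 0 < α_{i,1} < α₀ (the flag of α at the point i is nontrivial). Then Σ_{l≠m} (β^(l)_{i,0} − β^(l)_{i,1})·β^(m)_{i,1} ≥ 1, where the sum runs over ordered pairs of distinct indices 1 ≤ l, m ≤ N. -/
open Finset

/-- If `a` and `b` are nonnegative families whose sum is everywhere positive, neither vanishes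
identically and there are at least two indices, then the off-diagonal part of
`(∑ l, a l) * (∑ m, b m)` is positive. -/
theorem sum_offDiag_mul_pos {ι : Type*} [Fintype ι] [DecidableEq ι] [Nontrivial ι] {a b : ι → ℤ}
    (ha : ∀ l, 0 ≤ a l) (hb : ∀ l, 0 ≤ b l) (hab : ∀ l, 0 < a l + b l)
    (ha' : ∃ l, 0 < a l) (hb' : ∃ m, 0 < b m) :
    0 < ∑ l, ∑ m ∈ Finset.univ.erase l, a l * b m := by
  obtain ⟨l, m, hne, hl, hm⟩ : ∃ l m, m ≠ l ∧ 0 < a l ∧ 0 < b m := by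
    obtain ⟨l, hl⟩ := ha'
    obtain ⟨m, hm⟩ := hb'
    by_cases hml : m = l
    · subst hml
      obtain ⟨n, hn⟩ := exists_ne m
      by_cases hbn : 0 < b n
      · exact ⟨m, n, hn, hl, hbn⟩
      · exact ⟨n, m, hn.symm, by linarith [hab n], hm⟩
    · exact ⟨l, m, hml, hl, hm⟩
  have hnonneg : ∀ p q, 0 ≤ a p * b q := fun p q => mul_nonneg (ha p) (hb q)
  refine Finset.sum_pos' (fun p _ => Finset.sum_nonneg fun q _ => hnonneg p q)
    ⟨l, Finset.mem_univ l, ?_⟩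
  exact Finset.sum_pos' (fun q _ => hnonneg l q)
    ⟨m, Finset.mem_erase.2 ⟨hne, Finset.mem_univ m⟩, mul_pos hl hm⟩

theorem cross_term_pos_at_nontrivial_flag_point
    (k : ℕ) (hk : 0 < k) (w : Fin k → ℕ) (N : ℕ) (hN : 2 ≤ N)
    (α0 : ℕ) (α : Fin k → ℕ → ℕ) (hα0 : ∀ i, α i 0 = α0)
    (β0 : Fin N → ℕ) (β : Fin N → Fin k → ℕ → ℕ)
    (hβ0 : ∀ l i, β l i 0 = β0 l)
    (hsum0 : α0 = ∑ l, β0 l)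
    (hsum : ∀ i j, α i j = ∑ l, β l i j)
    (hmono : ∀ l i j, j < w i → β l i (j + 1) ≤ β l i j)
    (hpos : ∀ l, 1 ≤ β0 l)
    (i : Fin k) (hwi : 1 ≤ w i) (h1 : 0 < α i 1) (h2 : α i 1 < α0) :
    1 ≤ ∑ l, ∑ m ∈ Finset.univ.erase l,
        ((β l i 0 : ℤ) - (β l i 1 : ℤ)) * (β m i 1 : ℤ) := by
  have hle : ∀ l, β l i 1 ≤ β l i 0 := fun l => hmono l i 0 hwi
  have : Nontrivial (Fin N) := Fin.nontrivial_iff_two_le.2 hN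
  refine Int.add_one_le_iff.2 (sum_offDiag_mul_pos (a := fun l => (β l i 0 : ℤ) - (β l i 1 : ℤ))
    (b := fun m => (β m i 1 : ℤ)) (fun l => ?_) (fun m => by positivity) (fun l => ?_) ?_ ?_)
  · have := hle l
    grind
  · have := hpos l
    have := hβ0 l i
    grind
  · rw [← hα0 i, hsum i 1, hsum i 0] at h2
    obtain ⟨l, -, hl⟩ := Finset.exists_lt_of_sum_lt h2
    exact ⟨l, by grind⟩
  · rw [hsum i 1] at h1
    obtain ⟨m, -, hm⟩ := Finset.exists_ne_zero_of_sum_ne_zero h1.ne'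
    exact ⟨m, by exact_mod_cast Nat.pos_of_ne_zero hm⟩
end

section
/- Fix a positive integer k and weights w : {1,…,k} → ℕ. Let β^(1), …, β^(N) be dimension vectors of weight type w with N ≥ 2, each monotone with β^(l)₀ ≥ 1, and let α = β^(1) + ⋯ + β^(N) componentwise. Suppose i₁ ≠ i₂ are two distinct indices with w_{i₁} ≥ 1 and w_{i₂} ≥ 1 such that 0 < α_{i₁,1} < α₀ and 0 < α_{i₂,1} < α₀ (the flags of α at the two points are nontrivial). Then Σ_{l≠m} Σ_{i=1}^{k} Σ_{j=0}^{w_i−1} (β^(l)_{i,j} − β^(l)_{i,j+1})·β^(m)_{i,j+1} ≥ 2, where Σ_{l≠m} runs over ordered pairs of distinct indices 1 ≤ l, m ≤ N. -/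
open Finset

/-- If `d l + e l` is positive for every `l` in a type with at least two elements, and neither `d`
nor `e` vanishes identically, then they are nonzero at two distinct indices. -/
theorem exists_ne_pos_pos {ι : Type*} [Nontrivial ι] {d e : ι → ℕ}
    (hde : ∀ l, 0 < d l + e l) (hd : ∃ l, 0 < d l) (he : ∃ l, 0 < e l) :
    ∃ l m, m ≠ l ∧ 0 < d l ∧ 0 < e m := by
  by_contra! h
  obtain ⟨a, ha⟩ := hd
  obtain ⟨b, hb⟩ := he
  obtain ⟨c, hc⟩ := exists_ne a
  have hab : b = a := by
    by_contra hne
    have := h a b hne ha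
    omega
  subst hab
  have hec := h b c hc ha
  have hdc : ¬ 0 < d c := fun hdc => by
    have := h c b hc.symm hdc
    omega
  have := hde c
  omega

/-- The contribution to the cross term of one point of a family of flags is nonnegative. -/
theorem flagCrossTerm_nonneg {n : ℕ} {b c : ℕ → ℕ} (hb : ∀ j, j < n → b (j + 1) ≤ b j) :
    0 ≤ ∑ j ∈ Finset.range n, ((b j : ℤ) - (b (j + 1) : ℤ)) * (c (j + 1) : ℤ) :=
  Finset.sum_nonneg fun j hj => mul_nonneg
    (sub_nonneg.2 (by exact_mod_cast hb j (Finset.mem_range.1 hj))) (Int.natCast_nonneg _)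

/-- A point at which the total flag is nontrivial contributes at least one to the cross term. -/
theorem one_le_flagCrossTerm {ι : Type*} [Fintype ι] [DecidableEq ι] [Nontrivial ι]
    {n : ℕ} (hn : 1 ≤ n) {b : ι → ℕ → ℕ} (hb : ∀ l j, j < n → b l (j + 1) ≤ b l j)
    (hpos : ∀ l, 1 ≤ b l 0) (h1 : 0 < ∑ l, b l 1) (h2 : ∑ l, b l 1 < ∑ l, b l 0) :
    1 ≤ ∑ l, ∑ m ∈ Finset.univ.erase l, ∑ j ∈ Finset.range n,
      ((b l j : ℤ) - (b l (j + 1) : ℤ)) * (b m (j + 1) : ℤ) := by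
  obtain ⟨l, m, hml, hd, he⟩ := exists_ne_pos_pos
    (d := fun l => b l 0 - b l 1) (e := fun l => b l 1)
    (fun l => by have := hpos l; omega)
    (by
      obtain ⟨l, -, hl⟩ := Finset.exists_lt_of_sum_lt h2
      exact ⟨l, Nat.sub_pos_of_lt hl⟩)
    (by
      obtain ⟨l, -, hl⟩ := Finset.sum_pos_iff.1 h1
      exact ⟨l, hl⟩)
  have hterm : (1 : ℤ) ≤ ((b l 0 : ℤ) - (b l (0 + 1) : ℤ)) * (b m (0 + 1) : ℤ) :=
    one_le_mul_of_one_le_of_one_le (by simp only [zero_add]; omega)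
      (by exact_mod_cast he)
  calc (1 : ℤ) ≤ ((b l 0 : ℤ) - (b l (0 + 1) : ℤ)) * (b m (0 + 1) : ℤ) := hterm
    _ ≤ ∑ j ∈ Finset.range n, ((b l j : ℤ) - (b l (j + 1) : ℤ)) * (b m (j + 1) : ℤ) :=
      Finset.single_le_sum
        (f := fun j => ((b l j : ℤ) - (b l (j + 1) : ℤ)) * (b m (j + 1) : ℤ))
        (fun j hj => mul_nonneg
          (sub_nonneg.2 (by exact_mod_cast hb l j (Finset.mem_range.1 hj)))
          (Int.natCast_nonneg _))
        (Finset.mem_range.2 hn)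
    _ ≤ ∑ m ∈ Finset.univ.erase l, ∑ j ∈ Finset.range n,
          ((b l j : ℤ) - (b l (j + 1) : ℤ)) * (b m (j + 1) : ℤ) :=
      Finset.single_le_sum
        (f := fun m => ∑ j ∈ Finset.range n,
          ((b l j : ℤ) - (b l (j + 1) : ℤ)) * (b m (j + 1) : ℤ))
        (fun _ _ => flagCrossTerm_nonneg (hb l))
        (Finset.mem_erase.2 ⟨hml, Finset.mem_univ m⟩)
    _ ≤ _ :=
      Finset.single_le_sum
        (f := fun l => ∑ m ∈ Finset.univ.erase l, ∑ j ∈ Finset.range n,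
          ((b l j : ℤ) - (b l (j + 1) : ℤ)) * (b m (j + 1) : ℤ))
        (fun l _ => Finset.sum_nonneg fun _ _ => flagCrossTerm_nonneg (hb l))
        (Finset.mem_univ l)

theorem cross_term_ge_two_of_two_nontrivial_flag_points
    (k : ℕ) (hk : 0 < k) (w : Fin k → ℕ) (N : ℕ) (hN : 2 ≤ N)
    (α0 : ℕ) (α : Fin k → ℕ → ℕ) (hα0 : ∀ i, α i 0 = α0)
    (β0 : Fin N → ℕ) (β : Fin N → Fin k → ℕ → ℕ)
    (hβ0 : ∀ l i, β l i 0 = β0 l)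
    (hsum0 : α0 = ∑ l, β0 l)
    (hsum : ∀ i j, α i j = ∑ l, β l i j)
    (hmono : ∀ l i j, j < w i → β l i (j + 1) ≤ β l i j)
    (hpos : ∀ l, 1 ≤ β0 l)
    (i₁ i₂ : Fin k) (hne : i₁ ≠ i₂)
    (hw1 : 1 ≤ w i₁) (hw2 : 1 ≤ w i₂)
    (h11 : 0 < α i₁ 1) (h12 : α i₁ 1 < α0)
    (h21 : 0 < α i₂ 1) (h22 : α i₂ 1 < α0) :
    2 ≤ ∑ l, ∑ m ∈ Finset.univ.erase l, ∑ i : Fin k, ∑ j ∈ Finset.range (w i),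
        ((β l i j : ℤ) - (β l i (j + 1) : ℤ)) * (β m i (j + 1) : ℤ) := by
  have : Nontrivial (Fin N) := Fin.nontrivial_iff_two_le.2 hN
  have key : ∀ i, 1 ≤ w i → 0 < α i 1 → α i 1 < α0 →
      1 ≤ ∑ l, ∑ m ∈ Finset.univ.erase l, ∑ j ∈ Finset.range (w i),
        ((β l i j : ℤ) - (β l i (j + 1) : ℤ)) * (β m i (j + 1) : ℤ) := fun i hw h1 h2 =>
    one_le_flagCrossTerm (b := fun l => β l i) hw (fun l => hmono l i)
      (fun l => by simpa only [hβ0] using hpos l)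
      (by simpa only [hsum] using h1)
      (by simpa only [hsum, hsum0, hβ0] using h2)
  have hswap : (∑ l, ∑ m ∈ Finset.univ.erase l, ∑ i : Fin k, ∑ j ∈ Finset.range (w i),
        ((β l i j : ℤ) - (β l i (j + 1) : ℤ)) * (β m i (j + 1) : ℤ)) =
      ∑ i : Fin k, ∑ l, ∑ m ∈ Finset.univ.erase l, ∑ j ∈ Finset.range (w i),
        ((β l i j : ℤ) - (β l i (j + 1) : ℤ)) * (β m i (j + 1) : ℤ) := by
    rw [Finset.sum_comm (s := (Finset.univ : Finset (Fin k)))]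
    exact Finset.sum_congr rfl fun l _ => Finset.sum_comm
  rw [hswap]
  refine le_trans ?_ (Finset.add_le_sum
    (fun i _ => Finset.sum_nonneg fun l _ => Finset.sum_nonneg fun m _ =>
      flagCrossTerm_nonneg (hmono l i))
    (Finset.mem_univ i₁) (Finset.mem_univ i₂) hne)
  exact add_le_add (key i₁ hw1 h11 h12) (key i₂ hw2 h21 h22)
end
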